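/- arXiv:2110.08049 — 2 statements merged into one kernel-verified Lean document; each statement's English description precedes it below -/
import Mathlib

section
/- (Lemma 2, decomposition of the cross-entropy loss.) In the discrete semantic communication model, if the deterministic encoder f : ℳ → 𝒳 is injective (no semantic redundancy and no semantic ambiguity), then the cross-entropy loss decomposes as L_CE = H(X) - I(X;Y) + EKL; that is, -∑_{m,y} p m · W (f m) y · log (q y m) = (-∑_{x} pX x · log (pX x)) - (∑_{x,y} pX x · W x y · log (W x y / pY y)) + (∑_{m,y} p m · W (f m) y · log ((p m · W (f m) y / pY y) / (q y m))). -/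
/-- The fiber of an injective function over `f a` contributes only the term at `a`. -/
theorem sum_filter_apply_eq_of_injective {α β R : Type*} [Fintype α] [DecidableEq β]
    [AddCommMonoid R] {f : α → β} (hf : Function.Injective f) (p : α → R) (a : α) :
    ∑ b ∈ Finset.univ.filter (fun b => f b = f a), p b = p a := by
  classical
  simp [hf.eq_iff, Finset.sum_filter]

/-- Lemma 2 (decomposition of the cross-entropy loss): with an injective deterministic
encoder `f`, the cross-entropy loss decomposes as `L_CE = H(X) - I(X;Y) + EKL`. -/
theorem crossEntropy_decomposition
    {ℳ 𝒳 𝒴 : Type*} [Fintype ℳ] [Fintype 𝒳] [DecidableEq 𝒳] [Fintype 𝒴]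
    [Nonempty ℳ] [Nonempty 𝒳] [Nonempty 𝒴]
    (p : ℳ → ℝ) (hp : ∀ m, 0 ≤ p m) (hpsum : ∑ m, p m = 1)
    (f : ℳ → 𝒳) (hf : Function.Injective f)
    (W : 𝒳 → 𝒴 → ℝ) (hW : ∀ x y, 0 < W x y) (hWsum : ∀ x, ∑ y, W x y = 1)
    (q : 𝒴 → ℳ → ℝ) (hq : ∀ y m, 0 < q y m) (hqsum : ∀ y, ∑ m, q y m = 1)
    (pX : 𝒳 → ℝ) (hpX : ∀ x, pX x = ∑ m ∈ Finset.univ.filter (fun m => f m = x), p m)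
    (pY : 𝒴 → ℝ) (hpY : ∀ y, pY y = ∑ m, p m * W (f m) y) :
    -∑ m, ∑ y, p m * W (f m) y * Real.log (q y m) =
      (-∑ x, pX x * Real.log (pX x))
        - (∑ x, ∑ y, pX x * W x y * Real.log (W x y / pY y))
        + (∑ m, ∑ y, p m * W (f m) y *
            Real.log ((p m * W (f m) y / pY y) / (q y m))) := by
  have hpXf (m : ℳ) : pX (f m) = p m := by
    rw [hpX, sum_filter_apply_eq_of_injective hf]
  have hpX_zero (x : 𝒳) (hx : x ∉ Set.range f) : pX x = 0 := by
    rw [hpX]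
    refine Finset.sum_eq_zero fun m hm => ?_
    exact absurd ⟨m, (Finset.mem_filter.mp hm).2⟩ hx
  have hpY_pos (y : 𝒴) : 0 < pY y := by
    rw [hpY]
    obtain ⟨m, -, hm⟩ : ∃ m ∈ Finset.univ, 0 < p m :=
      (Finset.sum_pos_iff_of_nonneg fun m _ => hp m).mp (hpsum ▸ one_pos)
    exact Finset.sum_pos' (fun m _ => mul_nonneg (hp m) (hW _ _).le)
      ⟨m, Finset.mem_univ m, mul_pos hm (hW _ _)⟩
  have hH : ∑ x, pX x * Real.log (pX x) = ∑ m, ∑ y, p m * W (f m) y * Real.log (p m) := by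
    symm
    refine Fintype.sum_of_injective f hf _ _ (fun x hx => by simp [hpX_zero x hx]) fun m => ?_
    rw [← Finset.sum_mul, ← Finset.mul_sum, hWsum, mul_one, hpXf]
  have hI : ∑ x, ∑ y, pX x * W x y * Real.log (W x y / pY y) =
      ∑ m, ∑ y, p m * W (f m) y * Real.log (W (f m) y / pY y) := by
    symm
    exact Fintype.sum_of_injective f hf _ _ (fun x hx => by simp [hpX_zero x hx])
      fun m => by simp only [hpXf]
  rw [hH, hI]
  simp only [← Finset.sum_neg_distrib, ← Finset.sum_sub_distrib, ← Finset.sum_add_distrib]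
  refine Finset.sum_congr rfl fun m _ => Finset.sum_congr rfl fun y _ => ?_
  rcases (hp m).eq_or_lt with h | h
  · simp [← h]
  · have hWy := (hW (f m) y).ne'
    have hY := (hpY_pos y).ne'
    rw [Real.log_div (div_ne_zero (mul_ne_zero h.ne' hWy) hY) (hq y m).ne', mul_div_assoc,
      Real.log_mul h.ne' (div_ne_zero hWy hY)]
    ring
end

section
/- (Equality case of Lemma 3.) In the discrete semantic communication model with injective deterministic encoder f (so there is no semantic redundancy, H(X|M) = 0), for any real α and with β = 1, the semantic representation loss equals the cross-entropy loss minus α times the channel mutual information: H(X) - (1+α)·I(X;Y) + EKL = L_CE - α·I(X;Y). -/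
/-- A sum over the codomain of an injective map whose summand vanishes where the fibrewise weight
does is a sum over the domain. -/
theorem sum_fiberWeight_eq_of_injective {ι κ : Type*} [Fintype ι] [Fintype κ] [DecidableEq κ]
    {f : ι → κ} (hf : Function.Injective f) (p : ι → ℝ) (P : κ → ℝ)
    (hP : ∀ x, P x = ∑ m ∈ Finset.univ.filter (fun m => f m = x), p m)
    (g : κ → ℝ → ℝ) (hg : ∀ x, g x 0 = 0) :
    ∑ x, g x (P x) = ∑ m, g (f m) (p m) := by
  refine (Fintype.sum_of_injective f hf _ _ (fun x hx => ?_) (fun m => ?_)).symm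
  · have hfiber : P x = 0 := by
      rw [hP]
      refine Finset.sum_eq_zero fun m hm => ?_
      exact absurd ⟨m, (Finset.mem_filter.mp hm).2⟩ hx
    rw [hfiber, hg]
  · have hfiber : P (f m) = p m := by
      have hsingleton : Finset.univ.filter (fun m' => f m' = f m) = {m} := by
        ext m'
        simp [hf.eq_iff]
      rw [hP, hsingleton, Finset.sum_singleton]
    rw [hfiber]

/-- Equality case of Lemma 3: with injective deterministic encoder `f` and `β = 1`,
for any real `α`, the semantic representation loss equals the cross-entropy loss
minus `α` times the channel mutual information:
`H(X) - (1+α)·I(X;Y) + EKL = L_CE - α·I(X;Y)`. -/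
theorem semanticLoss_eq_crossEntropy_sub
    {ℳ 𝒳 𝒴 : Type*} [Fintype ℳ] [Fintype 𝒳] [DecidableEq 𝒳] [Fintype 𝒴]
    [Nonempty ℳ] [Nonempty 𝒳] [Nonempty 𝒴]
    (p : ℳ → ℝ) (hp : ∀ m, 0 ≤ p m) (hpsum : ∑ m, p m = 1)
    (f : ℳ → 𝒳) (hf : Function.Injective f)
    (W : 𝒳 → 𝒴 → ℝ) (hW : ∀ x y, 0 < W x y) (hWsum : ∀ x, ∑ y, W x y = 1)
    (q : 𝒴 → ℳ → ℝ) (hq : ∀ y m, 0 < q y m) (hqsum : ∀ y, ∑ m, q y m = 1)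
    (pX : 𝒳 → ℝ) (hpX : ∀ x, pX x = ∑ m ∈ Finset.univ.filter (fun m => f m = x), p m)
    (pY : 𝒴 → ℝ) (hpY : ∀ y, pY y = ∑ m, p m * W (f m) y)
    (α : ℝ) :
    (-∑ x, pX x * Real.log (pX x))
        - (1 + α) * (∑ x, ∑ y, pX x * W x y * Real.log (W x y / pY y))
        + (∑ m, ∑ y, p m * W (f m) y *
            Real.log ((p m * W (f m) y / pY y) / (q y m))) =
      (-∑ m, ∑ y, p m * W (f m) y * Real.log (q y m))
        - α * (∑ x, ∑ y, pX x * W x y * Real.log (W x y / pY y)) := by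
  have hpY_pos : ∀ y, 0 < pY y := by
    intro y
    obtain ⟨m, -, hm⟩ := Finset.exists_ne_zero_of_sum_ne_zero
      (hpsum.trans_ne one_ne_zero)
    rw [hpY]
    exact Finset.sum_pos' (fun m _ => mul_nonneg (hp m) (hW _ _).le)
      ⟨m, Finset.mem_univ m, mul_pos ((hp m).lt_of_ne' hm) (hW _ _)⟩
  have hentropy : ∑ x, pX x * Real.log (pX x)
      = ∑ m, ∑ y, p m * W (f m) y * Real.log (p m) := by
    rw [sum_fiberWeight_eq_of_injective hf p pX hpX (fun _ t => t * Real.log t) (by simp)]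
    refine Finset.sum_congr rfl fun m _ => ?_
    rw [← Finset.sum_mul, ← Finset.mul_sum, hWsum, mul_one]
  have hinformation : ∑ x, ∑ y, pX x * W x y * Real.log (W x y / pY y)
      = ∑ m, ∑ y, p m * W (f m) y * Real.log (W (f m) y / pY y) :=
    sum_fiberWeight_eq_of_injective hf p pX hpX
      (fun x t => ∑ y, t * W x y * Real.log (W x y / pY y)) (by simp)
  have hdivergence : ∑ m, ∑ y, p m * W (f m) y *
        Real.log ((p m * W (f m) y / pY y) / (q y m))
      = (∑ m, ∑ y, p m * W (f m) y * Real.log (p m))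
        + (∑ m, ∑ y, p m * W (f m) y * Real.log (W (f m) y / pY y))
        - ∑ m, ∑ y, p m * W (f m) y * Real.log (q y m) := by
    simp only [← Finset.sum_add_distrib, ← Finset.sum_sub_distrib]
    refine Finset.sum_congr rfl fun m _ => Finset.sum_congr rfl fun y _ => ?_
    rcases eq_or_ne (p m) 0 with hm | hm
    · simp [hm]
    · have hratio : W (f m) y / pY y ≠ 0 := (div_pos (hW _ _) (hpY_pos y)).ne'
      rw [mul_div_assoc, Real.log_div (mul_ne_zero hm hratio) (hq y m).ne',
        Real.log_mul hm hratio]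
      ring
  rw [hentropy, hinformation, hdivergence]
  ring
end
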